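/- Let C be a regular category, A an object of C, P a complete lattice, and H : P^op → RegEpi(A) a monotone map. The following are equivalent: (1) H preserves finite infima and non-empty suprema, and any two regular epimorphisms in the image of H ker-commute; (2) the presheaf γ_*H : P^op → C is a C-valued K-sheaf on P. -/

import Mathlib

open CategoryTheory CategoryTheory.Limits

universe w v u

class RegularCat (C : Type u) [Category.{v} C] [HasFiniteLimits C] : Prop where
  factor : ∀ {X Y : C} (f : X ⟶ Y), ∃ (Z : C) (e : X ⟶ Z) (m : Z ⟶ Y),
      Nonempty (RegularEpi e) ∧ Mono m ∧ e ≫ m = f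
  stable : ∀ {X Y Z : C} (f : X ⟶ Y) (g : Z ⟶ Y),
      Nonempty (RegularEpi f) → Nonempty (RegularEpi (pullback.snd f g))

variable {C : Type u} [Category.{v} C]

structure RegEpiOver (A : C) : Type (max u v) where
  cod : C
  hom : A ⟶ cod
  regEpi : Nonempty (RegularEpi hom)

/-- f ≤ g in RegEpi(A) iff g = h ∘ f for some h. -/
def RegEpiOver.le {A : C} (f g : RegEpiOver A) : Prop :=
  ∃ h : f.cod ⟶ g.cod, f.hom ≫ h = g.hom

variable [HasFiniteLimits C]

/-- The kernel pair of f, as a map into A ⨯ A. -/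
noncomputable def kerPairMap {A B : C} (f : A ⟶ B) : pullback f f ⟶ A ⨯ A :=
  prod.lift (pullback.fst f f) (pullback.snd f f)

/-- The object U in the construction of the composite of two relations r : R ↣ A × A and
s : S ↣ A × A: the equaliser of the two maps R ⨯ S ⟶ A given by the second leg of r and
the first leg of s. -/
noncomputable def relCompDom {A R S : C} (r : R ⟶ A ⨯ A) (s : S ⟶ A ⨯ A) : C :=
  equalizer ((prod.fst : R ⨯ S ⟶ R) ≫ r ≫ (prod.snd : A ⨯ A ⟶ A))
    ((prod.snd : R ⨯ S ⟶ S) ≫ s ≫ (prod.fst : A ⨯ A ⟶ A))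

/-- The canonical map U ⟶ A ⨯ A whose image is the composite relation r ∘ s. -/
noncomputable def relCompMap {A R S : C} (r : R ⟶ A ⨯ A) (s : S ⟶ A ⨯ A) :
    relCompDom r s ⟶ A ⨯ A :=
  equalizer.ι _ _ ≫
    prod.lift ((prod.fst : R ⨯ S ⟶ R) ≫ r ≫ (prod.fst : A ⨯ A ⟶ A))
      ((prod.snd : R ⨯ S ⟶ S) ≫ s ≫ (prod.snd : A ⨯ A ⟶ A))

/-- t : T ⟶ A ⨯ A is (an image factorisation of) the composite relation of r and s. -/
def IsRelComp {A R S T : C} (r : R ⟶ A ⨯ A) (s : S ⟶ A ⨯ A) (t : T ⟶ A ⨯ A) : Prop :=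
  ∃ e : relCompDom r s ⟶ T, Nonempty (RegularEpi e) ∧ e ≫ t = relCompMap r s

/-- Two monomorphisms into X determine the same subobject. -/
def SameSub {X T W : C} (t : T ⟶ X) (w : W ⟶ X) : Prop :=
  (∃ u : T ⟶ W, u ≫ w = t) ∧ (∃ v : W ⟶ T, v ≫ t = w)

/-- A relation t on A is effective if it is, as a subobject of A ⨯ A, the kernel pair
of some morphism. -/
def IsEffective {A T : C} (t : T ⟶ A ⨯ A) : Prop :=
  ∃ (B : C) (h : A ⟶ B), SameSub t (kerPairMap h)

/-- Two regular epimorphisms with domain A ker-commute: the composites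
ker f ∘ ker g and ker g ∘ ker f coincide (as subobjects of A ⨯ A) and this composite
is an effective equivalence relation. -/
def KerCommute {A : C} (f g : RegEpiOver A) : Prop :=
  ∃ (T : C) (t : T ⟶ A ⨯ A), Mono t ∧
    IsRelComp (kerPairMap f.hom) (kerPairMap g.hom) t ∧
    IsRelComp (kerPairMap g.hom) (kerPairMap f.hom) t ∧
    IsEffective t

variable {P : Type w} [CompleteLattice P]

/-- The presheaf γ_*H associated with a monotone map H : P^op → RegEpi(A): its
(uniquely determined) restriction maps, compatible with the quotient maps H(p). -/
structure GammaStar {A : C} (H : P → RegEpiOver A) where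
  map : ∀ {p q : P}, p ≤ q → ((H q).cod ⟶ (H p).cod)
  fac : ∀ {p q : P} (h : p ≤ q), (H q).hom ≫ map h = (H p).hom

/-- H sends the supremum of S (an infimum in P^op) to an infimum of {H p | p ∈ S}
in the preorder RegEpi(A). -/
def PreservesInfOf {A : C} (H : P → RegEpiOver A) (S : Set P) : Prop :=
  (∀ p ∈ S, (H (sSup S)).le (H p)) ∧
  ∀ t : RegEpiOver A, (∀ p ∈ S, t.le (H p)) → t.le (H (sSup S))

/-- H sends the infimum of S (a supremum in P^op) to a supremum of {H p | p ∈ S}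
in the preorder RegEpi(A). -/
def PreservesSupOf {A : C} (H : P → RegEpiOver A) (S : Set P) : Prop :=
  (∀ p ∈ S, (H p).le (H (sInf S))) ∧
  ∀ t : RegEpiOver A, (∀ p ∈ S, (H p).le t) → (H (sInf S)).le t

/-- The elementwise statement that the cocone (γ_*H(p) → γ_*H(inf D))_{p ∈ D} is a
colimit of the restriction of γ_*H to the codirected set D. -/
def GammaStar.IsColimitAtInf {A : C} {H : P → RegEpiOver A} (G : GammaStar H)
    (D : Set P) : Prop :=
  ∀ (B : C) (c : ∀ p ∈ D, (H p).cod ⟶ B),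
    (∀ p q (hp : p ∈ D) (hq : q ∈ D) (hpq : p ≤ q), G.map hpq ≫ c p hp = c q hq) →
    ∃! u : (H (sInf D)).cod ⟶ B, ∀ p (hp : p ∈ D), G.map (sInf_le hp) ≫ u = c p hp

/-- γ_*H is a C-valued K-sheaf on the complete lattice P:
(K1) γ_*H(⊥) is subterminal; (K2) binary restriction squares are pullbacks;
(K3) γ_*H sends codirected infima to (directed) colimits. -/
def GammaStar.IsKSheaf {A : C} {H : P → RegEpiOver A} (G : GammaStar H) : Prop :=
  Mono (terminal.from (H (⊥ : P)).cod) ∧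
  (∀ p q : P, IsPullback (G.map (le_sup_left : p ≤ p ⊔ q))
    (G.map (le_sup_right : q ≤ p ⊔ q))
    (G.map (inf_le_left : p ⊓ q ≤ p)) (G.map (inf_le_right : p ⊓ q ≤ q))) ∧
  (∀ D : Set P, D.Nonempty → DirectedOn (· ≥ ·) D → G.IsColimitAtInf D)

attribute [local simp] prod.lift_fst prod.lift_fst_assoc prod.lift_snd prod.lift_snd_assoc
  pullback.lift_fst pullback.lift_fst_assoc pullback.lift_snd pullback.lift_snd_assoc

section RegularCategory

theorem exists_fac_of_regularEpi {C : Type u} [Category.{v} C] {X Y Z : C} {f : X ⟶ Y}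
    (hf : Nonempty (RegularEpi f)) (k : X ⟶ Z)
    (hk : ∀ {T : C} (a b : T ⟶ X), a ≫ f = b ≫ f → a ≫ k = b ≫ k) : ∃ h : Y ⟶ Z, f ≫ h = k := by
  obtain ⟨r⟩ := hf
  obtain ⟨h, hh⟩ := r.desc' k (hk _ _ r.w)
  exact ⟨h, hh⟩

theorem strongEpi_of_nonempty_regularEpi {C : Type u} [Category.{v} C] {X Y : C} {f : X ⟶ Y}
    (hf : Nonempty (RegularEpi f)) : StrongEpi f := by
  have : IsRegularEpi f := ⟨hf⟩
  infer_instance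

instance RegEpiOver.strongEpi {A : C} (f : RegEpiOver A) : StrongEpi f.hom :=
  strongEpi_of_nonempty_regularEpi f.regEpi

variable [RegularCat C]

theorem regularEpi_of_strongEpi {X Y : C} (f : X ⟶ Y) [StrongEpi f] :
    Nonempty (RegularEpi f) := by
  obtain ⟨Z, e, m, ⟨he⟩, hm, rfl⟩ := RegularCat.factor f
  have : StrongEpi m := strongEpi_of_strongEpi e m
  have : IsIso m := isIso_of_mono_of_strongEpi m
  exact ⟨RegularEpi.ofArrowIso (Arrow.isoMk (f := .mk e) (g := .mk (e ≫ m)) (Iso.refl _)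
    (asIso m)) he⟩

theorem strongEpi_of_isPullback {W X Y Z : C} {fst : W ⟶ X} {snd : W ⟶ Z} {f : X ⟶ Y} {g : Z ⟶ Y}
    (h : IsPullback fst snd f g) [StrongEpi f] : StrongEpi snd := by
  have := strongEpi_of_nonempty_regularEpi
    (RegularCat.stable f g (regularEpi_of_strongEpi f))
  rw [← h.isoPullback_hom_snd]
  infer_instance

end RegularCategory

section Relations

instance kerPairMap_mono {A B : C} (f : A ⟶ B) : Mono (kerPairMap f) where
  right_cancellation a b h := by
    apply pullback.hom_ext
    · simpa [kerPairMap] using h =≫ prod.fst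
    · simpa [kerPairMap] using h =≫ prod.snd

theorem exists_comp_kerPairMap_eq {A B T : C} (f : A ⟶ B) (a : T ⟶ A ⨯ A)
    (h : a ≫ prod.fst ≫ f = a ≫ prod.snd ≫ f) : ∃ u : T ⟶ pullback f f, u ≫ kerPairMap f = a := by
  refine ⟨pullback.lift (a ≫ prod.fst) (a ≫ prod.snd) (by simpa using h), ?_⟩
  apply Limits.prod.hom_ext <;> simp [kerPairMap]

theorem kerPairMap_fst {A B : C} (f : A ⟶ B) : kerPairMap f ≫ prod.fst = pullback.fst f f :=
  prod.lift_fst _ _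

theorem kerPairMap_snd {A B : C} (f : A ⟶ B) : kerPairMap f ≫ prod.snd = pullback.snd f f :=
  prod.lift_snd _ _

theorem kerPairMap_condition {A B : C} (f : A ⟶ B) :
    kerPairMap f ≫ prod.fst ≫ f = kerPairMap f ≫ prod.snd ≫ f := by
  simp [kerPairMap, pullback.condition]

section Composite

variable {A R S : C} (r : R ⟶ A ⨯ A) (s : S ⟶ A ⨯ A)

/-- The first component of a pair of composable pairs. -/
noncomputable def relCompFst : relCompDom r s ⟶ R :=
  equalizer.ι ((prod.fst : R ⨯ S ⟶ R) ≫ r ≫ (prod.snd : A ⨯ A ⟶ A))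
    ((prod.snd : R ⨯ S ⟶ S) ≫ s ≫ (prod.fst : A ⨯ A ⟶ A)) ≫ prod.fst

/-- The second component of a pair of composable pairs. -/
noncomputable def relCompSnd : relCompDom r s ⟶ S :=
  equalizer.ι ((prod.fst : R ⨯ S ⟶ R) ≫ r ≫ (prod.snd : A ⨯ A ⟶ A))
    ((prod.snd : R ⨯ S ⟶ S) ≫ s ≫ (prod.fst : A ⨯ A ⟶ A)) ≫ prod.snd

theorem relCompDom_condition :
    relCompFst r s ≫ r ≫ prod.snd = relCompSnd r s ≫ s ≫ prod.fst :=
  (Category.assoc _ _ _).trans ((equalizer.condition _ _).trans (Category.assoc _ _ _).symm)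

theorem relCompMap_fst : relCompMap r s ≫ prod.fst = relCompFst r s ≫ r ≫ prod.fst :=
  (Category.assoc _ _ _).trans
    ((congrArg (equalizer.ι _ _ ≫ ·) (prod.lift_fst _ _)).trans (Category.assoc _ _ _).symm)

theorem relCompMap_snd : relCompMap r s ≫ prod.snd = relCompSnd r s ≫ s ≫ prod.snd :=
  (Category.assoc _ _ _).trans
    ((congrArg (equalizer.ι _ _ ≫ ·) (prod.lift_snd _ _)).trans (Category.assoc _ _ _).symm)

variable {r s}

theorem relCompDom_hom_ext {T : C} {a b : T ⟶ relCompDom r s}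
    (h₁ : a ≫ relCompFst r s = b ≫ relCompFst r s)
    (h₂ : a ≫ relCompSnd r s = b ≫ relCompSnd r s) : a = b :=
  equalizer.hom_ext (Limits.prod.hom_ext
    ((Category.assoc _ _ _).trans (h₁.trans (Category.assoc _ _ _).symm))
    ((Category.assoc _ _ _).trans (h₂.trans (Category.assoc _ _ _).symm)))

theorem exists_relCompDom_lift {T : C} (a : T ⟶ R) (b : T ⟶ S)
    (h : a ≫ r ≫ prod.snd = b ≫ s ≫ prod.fst) :
    ∃ l : T ⟶ relCompDom r s, l ≫ relCompFst r s = a ∧ l ≫ relCompSnd r s = b := by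
  let l : T ⟶ relCompDom r s := equalizer.lift (prod.lift a b) (by simpa using h)
  have hl : l ≫ equalizer.ι _ _ = prod.lift a b := equalizer.lift_ι _ _
  refine ⟨l, (Category.assoc _ _ _).symm.trans ?_, (Category.assoc _ _ _).symm.trans ?_⟩
  · exact (congrArg (· ≫ prod.fst) hl).trans (prod.lift_fst _ _)
  · exact (congrArg (· ≫ prod.snd) hl).trans (prod.lift_snd _ _)

end Composite

/-- The middle element of a pair of composable pairs in `ker f` and `ker g`. -/
noncomputable def relCompMid {A B B' : C} (f : A ⟶ B) (g : A ⟶ B') :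
    relCompDom (kerPairMap f) (kerPairMap g) ⟶ A :=
  relCompFst _ _ ≫ pullback.snd f f

theorem relCompMid_eq {A B B' : C} (f : A ⟶ B) (g : A ⟶ B') :
    relCompMid f g = relCompSnd _ _ ≫ pullback.fst g g := by
  simpa [relCompMid, kerPairMap_fst, kerPairMap_snd] using relCompDom_condition (kerPairMap f) (kerPairMap g)

theorem relCompMap_fst_comp {A B B' : C} (f : A ⟶ B) (g : A ⟶ B') :
    relCompMap (kerPairMap f) (kerPairMap g) ≫ prod.fst ≫ f = relCompMid f g ≫ f := by
  rw [reassoc_of% relCompMap_fst, reassoc_of% kerPairMap_fst, relCompMid, Category.assoc,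
    pullback.condition]

theorem relCompMap_snd_comp {A B B' : C} (f : A ⟶ B) (g : A ⟶ B') :
    relCompMap (kerPairMap f) (kerPairMap g) ≫ prod.snd ≫ g = relCompMid f g ≫ g := by
  rw [reassoc_of% relCompMap_snd, reassoc_of% kerPairMap_snd, relCompMid_eq, Category.assoc,
    pullback.condition]

theorem relComp_hom_ext {A B B' T : C} {f : A ⟶ B} {g : A ⟶ B'}
    {a b : T ⟶ relCompDom (kerPairMap f) (kerPairMap g)}
    (h : a ≫ relCompMap (kerPairMap f) (kerPairMap g) = b ≫ relCompMap _ _)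
    (hm : a ≫ relCompMid f g = b ≫ relCompMid f g) : a = b := by
  have h₁ := h =≫ prod.fst
  have h₂ := h =≫ prod.snd
  have hm₂ := hm
  simp only [Category.assoc, relCompMap_fst, relCompMap_snd, kerPairMap_fst, kerPairMap_snd]
    at h₁ h₂
  rw [relCompMid] at hm
  rw [relCompMid_eq] at hm₂
  apply relCompDom_hom_ext <;> apply pullback.hom_ext <;> simpa only [Category.assoc]

theorem exists_relComp_lift {A B B' T : C} (f : A ⟶ B) (g : A ⟶ B') (x z y : T ⟶ A)
    (hf : x ≫ f = z ≫ f) (hg : z ≫ g = y ≫ g) :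
    ∃ l : T ⟶ relCompDom (kerPairMap f) (kerPairMap g),
      l ≫ relCompMap _ _ = prod.lift x y ∧ l ≫ relCompMid f g = z := by
  obtain ⟨l, hl₁, hl₂⟩ := exists_relCompDom_lift (r := kerPairMap f) (s := kerPairMap g)
    (pullback.lift x z hf) (pullback.lift z y hg) (by simp [kerPairMap])
  refine ⟨l, ?_, ?_⟩
  · apply Limits.prod.hom_ext
    · simp [relCompMap_fst, kerPairMap_fst, reassoc_of% hl₁]
    · simp [relCompMap_snd, kerPairMap_snd, reassoc_of% hl₂]
  · simp [relCompMid, reassoc_of% hl₁]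

theorem IsRelComp.of_sameSub {A R S T W : C} {r : R ⟶ A ⨯ A} {s : S ⟶ A ⨯ A} {t : T ⟶ A ⨯ A}
    {w : W ⟶ A ⨯ A} [Mono t] [Mono w] (h : IsRelComp r s t) (hw : SameSub t w) :
    IsRelComp r s w := by
  obtain ⟨e, ⟨he⟩, het⟩ := h
  obtain ⟨⟨u, hu⟩, v, hv⟩ := hw
  let i : T ≅ W := ⟨u, v, by simp [← cancel_mono t, hu, hv], by simp [← cancel_mono w, hu, hv]⟩
  refine ⟨e ≫ u, ⟨RegularEpi.ofArrowIso (Arrow.isoMk (f := .mk e) (g := .mk (e ≫ u)) (Iso.refl _)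
    i) he⟩, by rw [Category.assoc, hu, het]⟩

/-- If the composite of the kernel pairs of `f` and `g` is the kernel pair of `h`, then every
quotient below which `f` and `g` lie also bounds `h`. -/
theorem exists_fac_of_isRelComp {A B B' D Z : C} {f : A ⟶ B} {g : A ⟶ B'} {h : A ⟶ D}
    (hh : Nonempty (RegularEpi h)) (hc : IsRelComp (kerPairMap f) (kerPairMap g) (kerPairMap h))
    (k : A ⟶ Z) (u : B ⟶ Z) (hu : f ≫ u = k) (w : B' ⟶ Z) (hw : g ≫ w = k) :
    ∃ x : D ⟶ Z, h ≫ x = k := by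
  obtain ⟨e, he, het⟩ := hc
  have := strongEpi_of_nonempty_regularEpi he
  have key : kerPairMap h ≫ prod.fst ≫ k = kerPairMap h ≫ prod.snd ≫ k := by
    rw [← cancel_epi e, reassoc_of% het, reassoc_of% het]
    have h₁ := relCompMap_fst_comp f g =≫ u
    have h₂ := relCompMap_snd_comp f g =≫ w
    simp only [Category.assoc, hu, hw] at h₁ h₂
    rw [h₁, h₂]
  refine exists_fac_of_regularEpi hh k fun a b hab => ?_
  obtain ⟨l, hl⟩ := exists_comp_kerPairMap_eq h (prod.lift a b) (by simpa using hab)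
  have := l ≫= key
  rw [reassoc_of% hl, reassoc_of% hl] at this
  simpa using this

section Square

variable {A B B' D Q : C} {f : A ⟶ B} {g : A ⟶ B'} {h : A ⟶ D} {b : B ⟶ D}
  {c : B' ⟶ D} {p₁ : Q ⟶ B} {p₂ : Q ⟶ B'} {l : A ⟶ Q}

theorem isPullback_relComp (hQ : IsPullback p₁ p₂ b c) (hl₁ : l ≫ p₁ = f) (hl₂ : l ≫ p₂ = g)
    (k : pullback h h ⟶ Q)
    (hk₁ : k ≫ p₁ = pullback.fst h h ≫ f) (hk₂ : k ≫ p₂ = pullback.snd h h ≫ g)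
    (e : relCompDom (kerPairMap f) (kerPairMap g) ⟶ pullback h h)
    (he : e ≫ kerPairMap h = relCompMap _ _) : IsPullback (relCompMid f g) e l k := by
  have he₁ : e ≫ pullback.fst h h = relCompMap (kerPairMap f) (kerPairMap g) ≫ prod.fst := by
    rw [← he, Category.assoc, kerPairMap_fst]
  have he₂ : e ≫ pullback.snd h h = relCompMap (kerPairMap f) (kerPairMap g) ≫ prod.snd := by
    rw [← he, Category.assoc, kerPairMap_snd]
  have w : relCompMid f g ≫ l = e ≫ k := by
    apply hQ.hom_ext
    · simp only [Category.assoc, hl₁, hk₁, reassoc_of% he₁, relCompMap_fst_comp]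
    · simp only [Category.assoc, hl₂, hk₂, reassoc_of% he₂, relCompMap_snd_comp]
  refine ⟨⟨w⟩, ⟨PullbackCone.isLimitAux' _ fun s => ?_⟩⟩
  have h₁ := s.condition =≫ p₁
  have h₂ := s.condition =≫ p₂
  simp only [Category.assoc, hl₁, hl₂, hk₁, hk₂] at h₁ h₂
  choose u hu hu' using exists_relComp_lift f g (s.snd ≫ pullback.fst h h) s.fst
    (s.snd ≫ pullback.snd h h) (by simp [h₁]) (by simp [h₂])
  have hs : u ≫ e = s.snd := by
    rw [← cancel_mono (kerPairMap h), Category.assoc, he, hu]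
    apply Limits.prod.hom_ext <;> simp [kerPairMap_fst, kerPairMap_snd]
  have uniq (m : s.pt ⟶ relCompDom (kerPairMap f) (kerPairMap g))
      (hm₁ : m ≫ relCompMid f g = s.fst) (hm₂ : m ≫ e = s.snd) : m = u := by
    refine relComp_hom_ext ?_ (hm₁.trans hu'.symm)
    rw [← he, reassoc_of% hs, reassoc_of% hm₂]
  exact ⟨u, hu', hs, fun {m} hm₁ hm₂ => uniq m hm₁ hm₂⟩

variable [RegularCat C]

theorem strongEpi_kerPair_to_pullback [StrongEpi f] [StrongEpi g] (hQ : IsPullback p₁ p₂ b c)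
    (hb : f ≫ b = h) (hc : g ≫ c = h) (k : pullback h h ⟶ Q)
    (hk₁ : k ≫ p₁ = pullback.fst h h ≫ f) (hk₂ : k ≫ p₂ = pullback.snd h h ≫ g) :
    StrongEpi k := by
  let m : pullback h h ⟶ pullback b h :=
    pullback.lift (pullback.fst h h ≫ f) (pullback.snd h h) (by simp [hb, pullback.condition])
  let n : pullback b h ⟶ Q :=
    hQ.lift (pullback.fst b h) (pullback.snd b h ≫ g) (by simp [hc, pullback.condition])
  have hm : IsPullback (pullback.fst h h) m f (pullback.fst b h) := by
    have big : IsPullback (pullback.fst h h) (m ≫ pullback.snd b h) (f ≫ b) h := by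
      simpa [m, hb] using IsPullback.of_hasPullback h h
    exact IsPullback.of_bot big (by simp [m]) (IsPullback.of_hasPullback b h)
  have hn : IsPullback (pullback.snd b h) n g p₂ := by
    have big : IsPullback (pullback.snd b h) (n ≫ p₁) (g ≫ c) b := by
      simpa [n, hc] using (IsPullback.of_hasPullback b h).flip
    exact IsPullback.of_bot big (by simp [n]) hQ.flip
  have := strongEpi_of_isPullback hm
  have := strongEpi_of_isPullback hn
  have : k = m ≫ n := hQ.hom_ext (by simp [m, n, hk₁]) (by simp [m, n, hk₂])
  rw [this]
  infer_instance

theorem isRelComp_of_strongEpi [StrongEpi l] (hQ : IsPullback p₁ p₂ b c)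
    (hb : f ≫ b = h) (hc : g ≫ c = h) (hl₁ : l ≫ p₁ = f) (hl₂ : l ≫ p₂ = g) :
    IsRelComp (kerPairMap f) (kerPairMap g) (kerPairMap h) := by
  obtain ⟨e, he⟩ := exists_comp_kerPairMap_eq h (relCompMap (kerPairMap f) (kerPairMap g)) (by
    have h₁ := relCompMap_fst_comp f g =≫ b
    have h₂ := relCompMap_snd_comp f g =≫ c
    simp only [Category.assoc, hb, hc] at h₁ h₂
    rw [h₁, h₂])
  have := strongEpi_of_isPullback (isPullback_relComp hQ hl₁ hl₂
    (hQ.lift (pullback.fst h h ≫ f) (pullback.snd h h ≫ g)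
      (by simp [hb, hc, pullback.condition])) (by simp) (by simp) e he)
  exact ⟨e, regularEpi_of_strongEpi e, he⟩

theorem strongEpi_of_isRelComp [StrongEpi f] [StrongEpi g] (hQ : IsPullback p₁ p₂ b c)
    (hb : f ≫ b = h) (hc : g ≫ c = h) (hl₁ : l ≫ p₁ = f) (hl₂ : l ≫ p₂ = g)
    (hr : IsRelComp (kerPairMap f) (kerPairMap g) (kerPairMap h)) : StrongEpi l := by
  obtain ⟨e, he, het⟩ := hr
  have := strongEpi_of_nonempty_regularEpi he
  let k : pullback h h ⟶ Q := hQ.lift (pullback.fst h h ≫ f) (pullback.snd h h ≫ g)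
    (by simp [hb, hc, pullback.condition])
  have : StrongEpi k := strongEpi_kerPair_to_pullback hQ hb hc k (by simp [k]) (by simp [k])
  have sq := isPullback_relComp hQ hl₁ hl₂ k (by simp [k]) (by simp [k]) e het
  have : StrongEpi (relCompMid f g ≫ l) := by
    rw [sq.w]
    infer_instance
  exact strongEpi_of_strongEpi (relCompMid f g) l

end Square

/-- If `f` and `g` ker-commute and `h` is their join among the regular quotients of `A`, then the
composite of their kernel pairs is the kernel pair of `h`. -/
theorem KerCommute.isRelComp [RegularCat C] {A : C} {f g h : RegEpiOver A} (hc : KerCommute f g)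
    (hf : f.le h) (hg : g.le h) (hh : ∀ t : RegEpiOver A, f.le t → g.le t → h.le t) :
    IsRelComp (kerPairMap f.hom) (kerPairMap g.hom) (kerPairMap h.hom) := by
  obtain ⟨T, t, _, hfg, -, Y, k, ⟨u, hu⟩, w, hw⟩ := hc
  refine hfg.of_sameSub ?_
  obtain ⟨e, he, het⟩ := hfg
  have := strongEpi_of_nonempty_regularEpi he
  obtain ⟨b, hb⟩ := hf
  obtain ⟨c, hc⟩ := hg
  refine ⟨exists_comp_kerPairMap_eq _ _ ?_, ?_⟩
  · rw [← cancel_epi e, reassoc_of% het, reassoc_of% het]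
    have h₁ := relCompMap_fst_comp f.hom g.hom =≫ b
    have h₂ := relCompMap_snd_comp f.hom g.hom =≫ c
    simp only [Category.assoc, hb, hc] at h₁ h₂
    rw [h₁, h₂]
  · have ht : t ≫ prod.fst ≫ k = t ≫ prod.snd ≫ k := by
      rw [← hu, Category.assoc, Category.assoc, kerPairMap_condition]
    have hcomp : relCompMap (kerPairMap f.hom) (kerPairMap g.hom) ≫ prod.fst ≫ k =
        relCompMap (kerPairMap f.hom) (kerPairMap g.hom) ≫ prod.snd ≫ k := by
      rw [← het, Category.assoc, Category.assoc, ht]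
    obtain ⟨Z, q, m, hq, _, rfl⟩ := RegularCat.factor k
    have hle : h.le ⟨Z, q, hq⟩ := by
      apply hh
      · refine exists_fac_of_regularEpi f.regEpi q fun x y hxy => ?_
        obtain ⟨l, hl, -⟩ := exists_relComp_lift f.hom g.hom x y y hxy rfl
        have := l ≫= hcomp
        rw [reassoc_of% hl, reassoc_of% hl] at this
        simpa [← Category.assoc, cancel_mono] using this
      · refine exists_fac_of_regularEpi g.regEpi q fun x y hxy => ?_
        obtain ⟨l, hl, -⟩ := exists_relComp_lift f.hom g.hom x x y rfl hxy
        have := l ≫= hcomp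
        rw [reassoc_of% hl, reassoc_of% hl] at this
        simpa [← Category.assoc, cancel_mono] using this
    obtain ⟨d, hd⟩ := hle
    obtain ⟨v, hv⟩ := exists_comp_kerPairMap_eq (q ≫ m) (kerPairMap h.hom) (by
      have := kerPairMap_condition h.hom =≫ (d ≫ m)
      dsimp only at hd
      simpa [reassoc_of% hd] using this)
    exact ⟨v ≫ w, by rw [Category.assoc, hw, hv]⟩

end Relations

section KSheaf

theorem GammaStar.le_map {C : Type u} [Category.{v} C] {A : C} {H : P → RegEpiOver A}
    (G : GammaStar H) {p q : P} (h : p ≤ q) : (H q).le (H p) :=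
  ⟨G.map h, G.fac h⟩

variable {A : C} {H : P → RegEpiOver A}

theorem le_of_mono_terminal_from (f : RegEpiOver A) [Mono (terminal.from f.cod)]
    (t : RegEpiOver A) : t.le f :=
  exists_fac_of_regularEpi t.regEpi f.hom fun a b _ => by
    rw [← cancel_mono (terminal.from f.cod)]
    exact Subsingleton.elim _ _

theorem mono_terminal_from_of_forall_le [RegularCat C] (f : RegEpiOver A) (hf : ∀ t : RegEpiOver A, t.le f) :
    Mono (terminal.from f.cod) := by
  obtain ⟨Z, q, m, hq, _, hqm⟩ := RegularCat.factor (terminal.from f.cod)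
  have := strongEpi_of_nonempty_regularEpi hq
  obtain ⟨s, hs⟩ := hf ⟨Z, f.hom ≫ q, regularEpi_of_strongEpi _⟩
  have : q ≫ s = 𝟙 _ := by
    rw [← cancel_epi f.hom]
    simpa using hs
  have : Mono q := (SplitMono.mk s this).mono
  rw [← hqm]
  exact mono_comp q m

namespace GammaStar

variable (G : GammaStar H)
include G

theorem isPullback_of_kerCommute [RegularCat C] {p q : P} (hinf : PreservesInfOf H {p, q})
    (hsup : PreservesSupOf H {p, q}) (hc : KerCommute (H p) (H q)) :
    IsPullback (G.map (le_sup_left : p ≤ p ⊔ q)) (G.map (le_sup_right : q ≤ p ⊔ q))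
      (G.map (inf_le_left : p ⊓ q ≤ p)) (G.map (inf_le_right : p ⊓ q ≤ q)) := by
  rw [PreservesInfOf, sSup_pair] at hinf
  rw [PreservesSupOf, sInf_pair] at hsup
  have hr := hc.isRelComp (G.le_map inf_le_left) (G.le_map inf_le_right)
    fun t h₁ h₂ => hsup.2 t (by simp [h₁, h₂])
  have w : G.map (le_sup_left : p ≤ p ⊔ q) ≫ G.map (inf_le_left : p ⊓ q ≤ p) =
      G.map (le_sup_right : q ≤ p ⊔ q) ≫ G.map (inf_le_right : p ⊓ q ≤ q) := by
    simp [← cancel_epi (H (p ⊔ q)).hom, reassoc_of% G.fac, G.fac]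
  have hQ := IsPullback.of_hasPullback (G.map (inf_le_left : p ⊓ q ≤ p))
    (G.map (inf_le_right : p ⊓ q ≤ q))
  let l : A ⟶ pullback (G.map (inf_le_left : p ⊓ q ≤ p)) (G.map (inf_le_right : p ⊓ q ≤ q)) :=
    pullback.lift (H p).hom (H q).hom (by simp [G.fac])
  have : StrongEpi l := strongEpi_of_isRelComp hQ (G.fac _) (G.fac _)
    (by simp [l]) (by simp [l]) hr
  let n := pullback.lift _ _ w
  have hn : (H (p ⊔ q)).hom ≫ n = l := by
    apply pullback.hom_ext <;> simp [n, l, G.fac]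
  obtain ⟨s, hs⟩ := hinf.2 ⟨_, l, regularEpi_of_strongEpi l⟩ (by
    rintro r (rfl | rfl)
    · exact ⟨pullback.fst _ _, by simp [l]⟩
    · exact ⟨pullback.snd _ _, by simp [l]⟩)
  dsimp only at s hs
  let i : (H (p ⊔ q)).cod ≅ _ := ⟨n, s, by
    rw [← cancel_epi (H (p ⊔ q)).hom, reassoc_of% hn, hs, Category.comp_id], by
    rw [← cancel_epi l, reassoc_of% hs, hn, Category.comp_id]⟩
  exact IsPullback.of_iso_pullback ⟨w⟩ i (by simp [i, n]) (by simp [i, n])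

theorem isColimitAtInf_of_preservesSupOf [RegularCat C] {D : Set P} (hne : D.Nonempty)
    (hD : DirectedOn (· ≥ ·) D) (hsup : PreservesSupOf H D) : G.IsColimitAtInf D := by
  intro B c hcc
  obtain ⟨p₀, hp₀⟩ := hne
  have key : ∀ p (hp : p ∈ D), (H p).hom ≫ c p hp = (H p₀).hom ≫ c p₀ hp₀ := by
    intro p hp
    obtain ⟨r, hr, hrp, hrp₀⟩ := hD p hp p₀ hp₀
    rw [← hcc r p hr hp hrp, ← hcc r p₀ hr hp₀ hrp₀, reassoc_of% G.fac, reassoc_of% G.fac]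
  obtain ⟨Z, q, m, hq, _, hqm⟩ := RegularCat.factor ((H p₀).hom ≫ c p₀ hp₀)
  obtain ⟨u, hu⟩ := hsup.2 ⟨Z, q, hq⟩ fun p hp =>
    exists_fac_of_regularEpi (H p).regEpi q fun a b hab => by
      rw [← cancel_mono m, Category.assoc, Category.assoc, hqm, ← key p hp, reassoc_of% hab]
  dsimp only at u hu
  refine ⟨u ≫ m, fun p hp => ?_, fun y hy => ?_⟩
  · rw [← cancel_epi (H p).hom, reassoc_of% G.fac, reassoc_of% hu, hqm, key p hp]
  · rw [← cancel_epi (H (sInf D)).hom, reassoc_of% hu, hqm, ← hy p₀ hp₀, reassoc_of% G.fac]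

namespace IsKSheaf

variable {G}

theorem le_sup (hG : G.IsKSheaf) {p q : P} {t : RegEpiOver A} (hp : t.le (H p))
    (hq : t.le (H q)) : t.le (H (p ⊔ q)) := by
  obtain ⟨a, ha⟩ := hp
  obtain ⟨b, hb⟩ := hq
  refine ⟨(hG.2.1 p q).lift a b ?_, (hG.2.1 p q).hom_ext ?_ ?_⟩
  · simp [← cancel_epi t.hom, reassoc_of% ha, reassoc_of% hb, G.fac]
  · simp [ha, G.fac]
  · simp [hb, G.fac]

theorem preservesInfOf (hG : G.IsKSheaf) {S : Set P} (hS : S.Finite) : PreservesInfOf H S := by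
  refine ⟨fun p hp => G.le_map (le_sSup hp), ?_⟩
  induction S, hS using Set.Finite.induction_on with
  | empty =>
    intro t _
    have := hG.1
    rw [sSup_empty]
    exact le_of_mono_terminal_from _ t
  | insert _ _ ih =>
    intro t ht
    rw [sSup_insert]
    exact hG.le_sup (ht _ (Set.mem_insert _ _)) (ih t fun p hp => ht p (Set.mem_insert_of_mem _ hp))

variable [RegularCat C]

theorem isRelComp (hG : G.IsKSheaf) (p q : P) :
    IsRelComp (kerPairMap (H p).hom) (kerPairMap (H q).hom) (kerPairMap (H (p ⊓ q)).hom) :=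
  isRelComp_of_strongEpi (l := (H (p ⊔ q)).hom) (hG.2.1 p q) (G.fac _) (G.fac _) (G.fac _) (G.fac _)

theorem isRelComp_symm (hG : G.IsKSheaf) (p q : P) :
    IsRelComp (kerPairMap (H q).hom) (kerPairMap (H p).hom) (kerPairMap (H (p ⊓ q)).hom) :=
  isRelComp_of_strongEpi (l := (H (p ⊔ q)).hom) (hG.2.1 p q).flip (G.fac _) (G.fac _) (G.fac _)
    (G.fac _)

theorem kerCommute (hG : G.IsKSheaf) (p q : P) : KerCommute (H p) (H q) :=
  ⟨_, kerPairMap (H (p ⊓ q)).hom, inferInstance, hG.isRelComp p q, hG.isRelComp_symm p q,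
    _, (H (p ⊓ q)).hom, ⟨𝟙 _, by simp⟩, 𝟙 _, by simp⟩

theorem inf_le (hG : G.IsKSheaf) {p q : P} {t : RegEpiOver A} (hp : (H p).le t)
    (hq : (H q).le t) : (H (p ⊓ q)).le t := by
  obtain ⟨a, ha⟩ := hp
  obtain ⟨b, hb⟩ := hq
  exact exists_fac_of_isRelComp (H (p ⊓ q)).regEpi (hG.isRelComp p q) t.hom a ha b hb

theorem preservesSupOf (hG : G.IsKSheaf) {S : Set P} (hS : S.Nonempty) : PreservesSupOf H S := by
  refine ⟨fun p hp => G.le_map (sInf_le hp), fun t ht => ?_⟩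
  let D : Set P := {d | sInf S ≤ d ∧ (H d).le t}
  have hSD : S ⊆ D := fun p hp => ⟨sInf_le hp, ht p hp⟩
  have hinf : sInf D = sInf S := le_antisymm (sInf_le_sInf hSD) (le_sInf fun d hd => hd.1)
  have hcol := hG.2.2 D (hS.mono hSD) fun p hp q hq =>
    ⟨p ⊓ q, ⟨le_inf hp.1 hq.1, hG.inf_le hp.2 hq.2⟩, inf_le_left, inf_le_right⟩
  choose c hc using fun p (hp : p ∈ D) => hp.2
  obtain ⟨u, hu, -⟩ := hcol t.cod c fun p q hp hq hpq => by
    rw [← cancel_epi (H q).hom, reassoc_of% G.fac, hc, hc]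
  rw [← hinf]
  obtain ⟨p, hp⟩ := hS
  exact ⟨u, by rw [← hc p (hSD hp), ← hu p (hSD hp), reassoc_of% G.fac]⟩

end IsKSheaf

end GammaStar

end KSheaf

theorem statement5 [RegularCat C] {A : C}
    (H : P → RegEpiOver A) (hH : ∀ {p q : P}, p ≤ q → (H q).le (H p))
    (G : GammaStar H) :
    -- (1): H preserves finite infima and non-empty suprema, and its image consists of
    -- pairwise ker-commuting elements
    ((∀ S : Set P, S.Finite → PreservesInfOf H S) ∧
     (∀ S : Set P, S.Nonempty → PreservesSupOf H S) ∧
     (∀ p q : P, KerCommute (H p) (H q))) ↔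
    -- (2): γ_*H is a C-valued K-sheaf on P
    G.IsKSheaf := by
  constructor
  · rintro ⟨hinf, hsup, hker⟩
    refine ⟨mono_terminal_from_of_forall_le _ fun t => ?_, fun p q => ?_, fun D hne hD => ?_⟩
    · simpa using (hinf ∅ Set.finite_empty).2 t
    · exact G.isPullback_of_kerCommute (hinf _ (Set.toFinite _)) (hsup _ (Set.insert_nonempty _ _))
        (hker p q)
    · exact G.isColimitAtInf_of_preservesSupOf hne hD (hsup D hne)
  · intro hG
    exact ⟨fun S hS => hG.preservesInfOf hS, fun S hS => hG.preservesSupOf hS, hG.kerCommute⟩
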